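/- Combinatorial Nullstellensatz modulo prime powers: Let p be a prime. Suppose f_1, f_2, …, f_n are polynomials in m variables over ℤ with zero constant terms, and Q_1, …, Q_n are sets with Q_i ⊆ ℤ/p^{d_i}ℤ and 0 ∈ Q_i for all i. If m > Σ_{i=1}^n deg(f_i)·price((ℤ/p^{d_i}ℤ) \ Q_i), then there exists a vector x ∈ {0,1}^m with x ≠ 0 such that for every i = 1,…,n, the residue of f_i(x) modulo p^{d_i} belongs to Q_i. -/

import Mathlib

/-- `h : ℚ[x]` is integer-valued: it takes integer values at all integers. -/
def IntValued (h : Polynomial ℚ) : Prop :=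
  ∀ t : ℤ, ∃ z : ℤ, Polynomial.eval (t : ℚ) h = (z : ℚ)

/-- `H` is a covering set for `B ⊆ ℤ/p^dℤ`: a finite set of integer-valued
rational polynomials `h` with `p ∤ h 0`, such that every integer `b` whose
residue modulo `p ^ d` lies in `B` satisfies `p ∣ h b` for some `h ∈ H`. -/
def CoversSet (p d : ℕ) (H : Finset (Polynomial ℚ)) (B : Set (ZMod (p ^ d))) : Prop :=
  (∀ h ∈ H, IntValued h) ∧
  (∀ h ∈ H, ∀ z : ℤ, Polynomial.eval (0 : ℚ) h = (z : ℚ) → ¬ (p : ℤ) ∣ z) ∧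
  (∀ b : ℤ, ((b : ZMod (p ^ d)) ∈ B) →
    ∃ h ∈ H, ∃ z : ℤ, Polynomial.eval (b : ℚ) h = (z : ℚ) ∧ (p : ℤ) ∣ z)

/-- `price B` is the minimum total degree `Σ_{h ∈ H} deg h` over all covering
sets `H` of `B`. -/
noncomputable def price (p d : ℕ) (B : Set (ZMod (p ^ d))) : ℕ :=
  sInf {s : ℕ | ∃ H : Finset (Polynomial ℚ),
    CoversSet p d H B ∧ s = ∑ h ∈ H, h.natDegree}

/-- The alternating sum over the vertices of the cube of a polynomial of degree less than the
dimension vanishes. -/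
theorem MvPolynomial.sum_neg_one_pow_card_mul_eval_indicator {σ R : Type*} [Fintype σ]
    [DecidableEq σ] [CommRing R] (P : MvPolynomial σ R) (hP : P.totalDegree < Fintype.card σ) :
    ∑ s : Finset σ, (-1) ^ s.card * MvPolynomial.eval (fun j ↦ if j ∈ s then (1 : R) else 0) P
      = 0 := by
  simp_rw [MvPolynomial.eval_eq', Finset.mul_sum]
  rw [Finset.sum_comm]
  refine Finset.sum_eq_zero fun a ha ↦ ?_
  obtain ⟨i, hi⟩ := P.exists_degree_lt 1 (by simpa using hP) ha
  have hprod : ∏ j : σ, ((-1 : R) + 0 ^ a j) = 0 :=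
    Finset.prod_eq_zero (Finset.mem_univ i) (by simp [Nat.lt_one_iff.mp hi])
  rw [Finset.prod_add, Finset.powerset_univ] at hprod
  refine Eq.trans ?_ ((congrArg (P.coeff a * ·) hprod).trans (mul_zero _))
  simp only [Finset.mul_sum]
  refine Finset.sum_congr rfl fun s _ ↦ ?_
  have hs : ∏ j : σ, (if j ∈ s then (1 : R) else 0) ^ a j = ∏ j ∈ Finset.univ \ s, 0 ^ a j := by
    rw [← Finset.prod_sdiff (Finset.subset_univ s),
      Finset.prod_congr (s₁ := s) rfl (g := fun _ ↦ 1) fun j hj ↦ by simp [hj]]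
    simp only [Finset.prod_const_one, mul_one]
    exact Finset.prod_congr rfl fun j hj ↦ by simp [(Finset.mem_sdiff.mp hj).2]
  rw [hs, Finset.prod_const]
  ring

theorem MvPolynomial.totalDegree_aeval_polynomial_le {σ R : Type*} [CommRing R]
    (h : Polynomial R) (g : MvPolynomial σ R) :
    (Polynomial.aeval g h).totalDegree ≤ h.natDegree * g.totalDegree := by
  rw [Polynomial.aeval_eq_sum_range]
  refine MvPolynomial.totalDegree_finsetSum_le fun k hk ↦ ?_
  refine (MvPolynomial.totalDegree_smul_le _ _).trans ((MvPolynomial.totalDegree_pow _ _).trans ?_)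
  exact Nat.mul_le_mul_right _ (Nat.lt_succ_iff.mp (Finset.mem_range.mp hk))

/-- The binomial coefficient `(x - 1 choose n)` as a polynomial in `x`. -/
noncomputable def shiftedChoosePoly (n : ℕ) : Polynomial ℚ :=
  Polynomial.C ((n.factorial : ℚ)⁻¹) * (descPochhammer ℚ n).comp (Polynomial.X - 1)

theorem eval_shiftedChoosePoly (n : ℕ) (t : ℤ) :
    (shiftedChoosePoly n).eval (t : ℚ) = (Ring.choose (t - 1) n : ℤ) := by
  have h := Ring.map_choose (Int.castRingHom ℚ) (t - 1) n
  simp only [eq_intCast] at h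
  rw [h, Ring.choose_eq_smul, ← Polynomial.aeval_eq_smeval, Polynomial.aeval_def,
    Polynomial.eval₂_eq_eval_map, descPochhammer_map]
  simp [shiftedChoosePoly, Polynomial.eval_comp]

theorem not_dvd_choose_neg_one {p : ℕ} (hp : p.Prime) (n : ℕ) :
    ¬ (p : ℤ) ∣ Ring.choose (-1 : ℤ) n := by
  rw [Ring.choose_neg]
  simp only [add_sub_cancel_left, Ring.choose_natCast, Nat.choose_self]
  intro h
  have h1 : IsUnit (p : ℤ) := by
    refine isUnit_of_dvd_unit h ?_
    rw [Units.smul_def]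
    simp
  exact (Nat.prime_iff_prime_int.mp hp).not_isUnit h1

theorem dvd_choose_sub_one_of_not_dvd {p d : ℕ} (hp : p.Prime) {t : ℤ} (ht : ¬ (p : ℤ) ^ d ∣ t) :
    (p : ℤ) ∣ Ring.choose (t - 1) (p ^ d - 1) := by
  have key := Ring.choose_smul_choose t (n := p ^ d) (k := 1)
    (Nat.pos_of_ne_zero (pow_ne_zero _ hp.ne_zero))
  simp only [Nat.choose_one_right, Ring.choose_one_right, nsmul_eq_mul, Nat.cast_pow,
    Nat.cast_one] at key
  by_contra hc
  have hcop : IsCoprime ((p : ℤ) ^ d) (Ring.choose (t - 1) (p ^ d - 1)) :=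
    ((Nat.prime_iff_prime_int.mp hp).coprime_iff_not_dvd.mpr hc).pow_left
  exact ht (hcop.dvd_of_dvd_mul_right (Dvd.intro _ key))

theorem coversSet_shiftedChoosePoly {p d : ℕ} (hp : p.Prime) {B : Set (ZMod (p ^ d))}
    (hB : (0 : ZMod (p ^ d)) ∉ B) : CoversSet p d {shiftedChoosePoly (p ^ d - 1)} B := by
  simp only [CoversSet, Finset.mem_singleton, forall_eq, exists_eq_left]
  refine ⟨fun t ↦ ⟨_, eval_shiftedChoosePoly _ t⟩, fun z hz ↦ ?_, fun b hb ↦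
    ⟨_, eval_shiftedChoosePoly _ b, dvd_choose_sub_one_of_not_dvd hp fun hdvd ↦ hB ?_⟩⟩
  · have h := eval_shiftedChoosePoly (p ^ d - 1) 0
    rw [Int.cast_zero, hz, Int.cast_inj] at h
    rw [h, zero_sub]
    exact not_dvd_choose_neg_one hp _
  · rwa [← (ZMod.intCast_zmod_eq_zero_iff_dvd b (p ^ d)).mpr (by exact_mod_cast hdvd)]

theorem exists_coversSet_sum_natDegree_eq_price {p d : ℕ} (hp : p.Prime) {B : Set (ZMod (p ^ d))}
    (hB : (0 : ZMod (p ^ d)) ∉ B) :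
    ∃ H, CoversSet p d H B ∧ price p d B = ∑ h ∈ H, h.natDegree := by
  have hne : {s : ℕ | ∃ H : Finset (Polynomial ℚ),
      CoversSet p d H B ∧ s = ∑ h ∈ H, h.natDegree}.Nonempty :=
    ⟨_, _, coversSet_shiftedChoosePoly hp hB, rfl⟩
  exact Nat.sInf_mem hne

/-- **Combinatorial Nullstellensatz modulo prime powers.**
If `f 1, …, f n` are `m`-variable integer polynomials with zero constant term,
`0 ∈ Q i ⊆ ℤ/p^{d i}ℤ`, and `m > Σᵢ deg(f i) · price((ℤ/p^{d i}ℤ) \ Q i)`,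
then some nonzero `0`-`1` vector `x` has `f i (x) mod p ^ d i ∈ Q i` for all `i`. -/
theorem combinatorial_nullstellensatz_mod_prime_powers
    (p n m : ℕ) (hp : p.Prime) (d : Fin n → ℕ)
    (f : Fin n → MvPolynomial (Fin m) ℤ)
    (hf0 : ∀ i, MvPolynomial.coeff 0 (f i) = 0)
    (Q : (i : Fin n) → Set (ZMod (p ^ d i)))
    (hQ0 : ∀ i, (0 : ZMod (p ^ d i)) ∈ Q i)
    (hm : ∑ i, (f i).totalDegree * price p (d i) ((Q i)ᶜ) < m) :
    ∃ x : Fin m → ℤ, (∀ j, x j = 0 ∨ x j = 1) ∧ x ≠ 0 ∧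
      ∀ i, ((MvPolynomial.eval x (f i) : ℤ) : ZMod (p ^ d i)) ∈ Q i := by
  have hpZ := Nat.prime_iff_prime_int.mp hp
  choose H hH hprice using fun i ↦
    exists_coversSet_sum_natDegree_eq_price hp (B := (Q i)ᶜ) (by simpa using hQ0 i)
  by_contra! hcon
  have hfloor : ∀ i, ∀ h ∈ H i, ∀ t : ℤ, h.eval (t : ℚ) = (⌊h.eval (t : ℚ)⌋ : ℤ) := by
    intro i h hh t
    obtain ⟨z, hz⟩ := (hH i).1 h hh t
    rw [hz, Int.floor_intCast]
  let ind (s : Finset (Fin m)) : Fin m → ℤ := fun j ↦ if j ∈ s then 1 else 0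
  let F (s : Finset (Fin m)) : ℤ :=
    ∏ i, ∏ h ∈ H i, ⌊h.eval ((MvPolynomial.eval (ind s) (f i) : ℤ) : ℚ)⌋
  let P : MvPolynomial (Fin m) ℚ :=
    ∏ i, ∏ h ∈ H i, Polynomial.aeval (MvPolynomial.map (Int.castRingHom ℚ) (f i)) h
  have hPdeg : P.totalDegree < Fintype.card (Fin m) := by
    rw [Fintype.card_fin]
    refine lt_of_le_of_lt ?_ hm
    refine (MvPolynomial.totalDegree_finsetProd _ _).trans (Finset.sum_le_sum fun i _ ↦ ?_)
    rw [hprice, Finset.mul_sum]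
    refine (MvPolynomial.totalDegree_finsetProd _ _).trans (Finset.sum_le_sum fun h _ ↦ ?_)
    rw [mul_comm]
    exact (MvPolynomial.totalDegree_aeval_polynomial_le _ _).trans
      (Nat.mul_le_mul_left _ (Finset.sup_mono (MvPolynomial.support_map_subset _ _)))
  have hPF (s : Finset (Fin m)) :
      MvPolynomial.eval (fun j ↦ if j ∈ s then (1 : ℚ) else 0) P = (F s : ℤ) := by
    simp only [P, F, map_prod, Int.cast_prod]
    refine Finset.prod_congr rfl fun i _ ↦ Finset.prod_congr rfl fun h hh ↦ ?_
    rw [← hfloor i h hh, ← MvPolynomial.coe_aeval_eq_eval, RingHom.coe_coe,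
      ← Polynomial.aeval_algHom_apply, MvPolynomial.aeval_eq_eval, Polynomial.coe_aeval_eq_eval]
    congr 1
    have hind : (fun j ↦ if j ∈ s then (1 : ℚ) else 0) = Int.castRingHom ℚ ∘ ind s := by
      ext j
      simp only [ind, Function.comp_apply, eq_intCast]
      split_ifs <;> simp
    rw [hind, MvPolynomial.eval_map]
    exact (MvPolynomial.eval₂_comp_left (Int.castRingHom ℚ) (RingHom.id ℤ) (ind s) (f i)).symm
  have hsum : ∑ s, (-1) ^ s.card * F s = 0 := by
    have h := P.sum_neg_one_pow_card_mul_eval_indicator hPdeg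
    simp only [hPF] at h
    exact_mod_cast h
  have hne (s : Finset (Fin m)) (hs : s ≠ ∅) : (p : ℤ) ∣ F s := by
    obtain ⟨j, hj⟩ := Finset.nonempty_of_ne_empty hs
    obtain ⟨i, hi⟩ := hcon (ind s) (fun j ↦ by simp only [ind]; split_ifs <;> simp)
      (fun h ↦ by simpa [ind, hj] using congrFun h j)
    obtain ⟨h, hh, z, hz, hpz⟩ := (hH i).2.2 _ hi
    refine dvd_trans ?_ (Finset.dvd_prod_of_mem _ (Finset.mem_univ i))
    refine dvd_trans ?_ (Finset.dvd_prod_of_mem _ hh)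
    rwa [hz, Int.floor_intCast]
  have hempty : ¬ (p : ℤ) ∣ F ∅ := by
    intro hdvd
    obtain ⟨i, -, hi⟩ := hpZ.exists_mem_finset_dvd hdvd
    obtain ⟨h, hh, hdvd⟩ := hpZ.exists_mem_finset_dvd hi
    have h0 : MvPolynomial.eval (ind ∅) (f i) = 0 := by
      have : ind ∅ = 0 := by ext j; simp [ind]
      rw [this, MvPolynomial.eval_zero, MvPolynomial.constantCoeff_eq, hf0]
    refine (hH i).2.1 h hh _ ?_ hdvd
    rw [← hfloor i h hh, h0, Int.cast_zero]
  rw [← Finset.add_sum_erase _ _ (Finset.mem_univ ∅), Finset.card_empty, pow_zero, one_mul] at hsum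
  refine hempty ((dvd_add_left (Finset.dvd_sum fun s hs ↦ ?_)).mp (hsum ▸ dvd_zero _))
  exact (hne s (Finset.ne_of_mem_erase hs)).mul_left _
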